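/- arXiv:1011.1689 — 2 statements merged into one kernel-verified Lean document; each statement's English description precedes it below -/
import Mathlib

section
/- Let S be a white noise stochastic flow on a Polish space X with Markov semigroup P_{st}f(x) := 𝔼[f(S(t,s;·)x)], and let {ρ_s}_{s∈ℝ} be an evolution system of measures for {P_{st}}. Fix t ∈ ℝ. Then there exists a random probability measure ω ↦ μ_{tω} on X such that for every deterministic sequence s_n → −∞, the random probability measures ν_n(ω) := S(t,s_n;ω)ρ_{s_n} (the pushforward of ρ_{s_n} under x ↦ S(t,s_n;ω)x) converge weakly to μ_{tω} for ℙ-a.e. ω; in particular the a.s. limit does not depend on the chosen sequence. -/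
open MeasureTheory Filter Topology

/-- A stochastic flow on a metric space `X` over a probability space `(Ω, 𝓕, ℙ)`:
a family of maps `S t s ω : X → X` (for `s ≤ t`) satisfying, for `ℙ`-a.e. `ω`,
the cocycle property, continuity in `x`, the identity at equal times, and a joint
measurability condition in `(s, ω)` on `(-∞, t] × Ω`. -/
def IsStochasticFlow {Ω X : Type*} [MeasurableSpace Ω] [MetricSpace X]
    [MeasurableSpace X] [BorelSpace X]
    (ℙ : Measure Ω) (S : ℝ → ℝ → Ω → X → X) : Prop :=
  (∀ᵐ ω ∂ℙ,
    (∀ s r t : ℝ, s ≤ r → r ≤ t → ∀ x : X, S t r ω (S r s ω x) = S t s ω x) ∧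
    (∀ s t : ℝ, s ≤ t → Continuous fun x : X => S t s ω x) ∧
    (∀ t : ℝ, ∀ x : X, S t t ω x = x)) ∧
  (∀ t : ℝ, ∀ x : X, Measurable fun p : {s : ℝ // s ≤ t} × Ω => S t p.1.1 p.2 x)

/-- `K` is an attracting set at time `t` for the sample point `ω`: every nonempty
bounded set `B` satisfies `d(S(t,s;ω)B, K) → 0` as `s → -∞`, where
`d(A,B) = sup_{x ∈ A} inf_{y ∈ B} d(x,y)` (formulated with `EMetric.infEdist`). -/
def Attracts {Ω X : Type*} [MetricSpace X]
    (S : ℝ → ℝ → Ω → X → X) (t : ℝ) (ω : Ω) (K : Set X) : Prop :=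
  ∀ B : Set X, B.Nonempty → Bornology.IsBounded B →
    Tendsto (fun s : ℝ => ⨆ x ∈ B, EMetric.infEdist (S t s ω x) K) atBot (𝓝 0)

/-- The stochastic flow `S` is asymptotically compact with compact attracting sets `K t ω`
on a full-measure set `Ω₀`. -/
def IsAsymptoticallyCompact {Ω X : Type*} [MeasurableSpace Ω] [MetricSpace X]
    (ℙ : Measure Ω) (S : ℝ → ℝ → Ω → X → X) : Prop :=
  ∃ Ω₀ : Set Ω, MeasurableSet Ω₀ ∧ ℙ Ω₀ = 1 ∧
    ∀ ω ∈ Ω₀, ∀ t : ℝ, ∃ K : Set X, IsCompact K ∧ Attracts S t ω K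

/-- An evolution system of measures for the stochastic flow `S`: a family of probability
measures `μ t` on `Ω × X` with marginal `ℙ` on `Ω`, such that the image of `μ s` under
`(ω, x) ↦ (ω, S t s ω x)` is `μ t` whenever `s ≤ t`. -/
def IsEvolutionSystem {Ω X : Type*} [MeasurableSpace Ω] [MeasurableSpace X]
    (ℙ : Measure Ω) (S : ℝ → ℝ → Ω → X → X) (μ : ℝ → Measure (Ω × X)) : Prop :=
  (∀ t : ℝ, IsProbabilityMeasure (μ t)) ∧
  (∀ t : ℝ, (μ t).map Prod.fst = ℙ) ∧
  (∀ s t : ℝ, s ≤ t → (μ s).map (fun p : Ω × X => (p.1, S t s p.1 p.2)) = μ t)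

/-- The `ℙ`-completion of a sub-σ-algebra `m`: generated by all sets differing from an
`m`-measurable set by a `ℙ`-null set. -/
def completionOf {Ω : Type*} [MeasurableSpace Ω] (ℙ : Measure Ω)
    (m : MeasurableSpace Ω) : MeasurableSpace Ω :=
  MeasurableSpace.generateFrom {A | ∃ B : Set Ω, MeasurableSet[m] B ∧ ℙ (symmDiff A B) = 0}

/-- The σ-algebra generated by the random variables `ω ↦ S u t ω x` with `s ≤ t ≤ u`. -/
def sigmaGe {Ω X : Type*} [MeasurableSpace X] (S : ℝ → ℝ → Ω → X → X) (s : ℝ) :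
    MeasurableSpace Ω :=
  MeasurableSpace.generateFrom
    {A | ∃ (t u : ℝ) (x : X) (B : Set X), s ≤ t ∧ t ≤ u ∧ MeasurableSet B ∧
      A = {ω | S u t ω x ∈ B}}

/-- The σ-algebra generated by the random variables `ω ↦ S u t ω x` with `t ≤ u ≤ s`. -/
def sigmaLe {Ω X : Type*} [MeasurableSpace X] (S : ℝ → ℝ → Ω → X → X) (s : ℝ) :
    MeasurableSpace Ω :=
  MeasurableSpace.generateFrom
    {A | ∃ (t u : ℝ) (x : X) (B : Set X), t ≤ u ∧ u ≤ s ∧ MeasurableSet B ∧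
      A = {ω | S u t ω x ∈ B}}

/-- `𝓕_{≥ s}`: the `ℙ`-completion of the σ-algebra generated by the flow after time `s`. -/
def Fge {Ω X : Type*} [MeasurableSpace Ω] [MeasurableSpace X]
    (ℙ : Measure Ω) (S : ℝ → ℝ → Ω → X → X) (s : ℝ) : MeasurableSpace Ω :=
  completionOf ℙ (sigmaGe S s)

/-- `𝓕_{≤ s}`: the `ℙ`-completion of the σ-algebra generated by the flow before time `s`. -/
def Fle {Ω X : Type*} [MeasurableSpace Ω] [MeasurableSpace X]
    (ℙ : Measure Ω) (S : ℝ → ℝ → Ω → X → X) (s : ℝ) : MeasurableSpace Ω :=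
  completionOf ℙ (sigmaLe S s)

/-- A white noise stochastic flow: a stochastic flow such that for every `s ∈ ℝ`, the
σ-algebras `𝓕_{≥ s}` and `𝓕_{≤ s}` are independent. -/
def IsWhiteNoiseFlow {Ω X : Type*} [MeasurableSpace Ω] [MetricSpace X]
    [MeasurableSpace X] [BorelSpace X]
    (ℙ : Measure Ω) (S : ℝ → ℝ → Ω → X → X) : Prop :=
  IsStochasticFlow ℙ S ∧
  ∀ s : ℝ, ProbabilityTheory.Indep (Fge ℙ S s) (Fle ℙ S s) ℙ

/-- An evolution system of measures for the Markov transition semigroup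
`P_{st} f x = 𝔼[f (S t s · x)]` associated to the flow `S`: a family of Borel
probability measures `ρ s` on `X` with `P_{st} ρ_s = ρ_t` for all `s ≤ t`. -/
def IsMarkovEvolutionSystem {Ω X : Type*} [MeasurableSpace Ω] [MeasurableSpace X]
    (ℙ : Measure Ω) (S : ℝ → ℝ → Ω → X → X) (ρ : ℝ → Measure X) : Prop :=
  (∀ t : ℝ, IsProbabilityMeasure (ρ t)) ∧
  (∀ s t : ℝ, s ≤ t → ∀ B : Set X, MeasurableSet B →
    (∫⁻ x, ℙ {ω | S t s ω x ∈ B} ∂(ρ s)) = ρ t B)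

open ProbabilityTheory in
lemma lintegral_comp_prodMk_of_indepFun {Ω Ω' X : Type*} [MeasurableSpace Ω] [MeasurableSpace Ω']
    [MeasurableSpace X] {P : Measure Ω} [IsFiniteMeasure P] {g : Ω → Ω'} {Z : Ω → X}
    (hg : Measurable g) (hZ : Measurable Z) (h : IndepFun g Z P)
    {φ : Ω' × X → ENNReal} (hφ : Measurable φ) :
    ∫⁻ ω, φ (g ω, Z ω) ∂P = ∫⁻ ω, ∫⁻ ω', φ (g ω', Z ω) ∂P ∂P := by
  rw [← lintegral_map hφ (hg.prodMk hZ), h.map_prod_eq_prod_map_map hg.aemeasurable hZ.aemeasurable,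
    lintegral_prod_symm' _ hφ, lintegral_map (hφ.lintegral_prod_left') hZ]
  refine lintegral_congr fun ω => ?_
  rw [lintegral_map (by fun_prop) hg]

/-- A random continuous map is jointly measurable in the sample point and the space variable. -/
lemma measurable_uncurry_of_forall_continuous {Ω X : Type*} {m : MeasurableSpace Ω}
    [MetricSpace X] [TopologicalSpace.SeparableSpace X] [MeasurableSpace X] [BorelSpace X]
    {F : Ω → X → X} (hc : ∀ ω, Continuous (F ω)) (hm : ∀ x, Measurable fun ω => F ω x) :
    Measurable fun p : Ω × X => F p.1 p.2 :=
  have := UniformSpace.secondCountable_of_separable X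
  (measurable_uncurry_of_continuous_of_measurable (u := fun x ω => F ω x) hc hm).comp
    measurable_swap

lemma measurable_indicator_mul_indicator {Ω X Y : Type*} {m : MeasurableSpace Ω}
    [MeasurableSpace X] [MeasurableSpace Y] {A : Set Ω} (hA : MeasurableSet A) {B : Set Y}
    (hB : MeasurableSet B) {F : Ω × X → Y} (hF : Measurable F) :
    Measurable fun p : Ω × X => A.indicator 1 p.1 * B.indicator (1 : Y → ENNReal) (F p) :=
  ((measurable_one.indicator hA).comp measurable_fst).mul ((measurable_one.indicator hB).comp hF)

/-- A family of random maps that satisfies the defining properties of a white noise flow at every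
sample point, where `G r` collects the information about the flow after time `r`. -/
structure IsAdaptedFlow {Ω X : Type*} [mΩ : MeasurableSpace Ω] [TopologicalSpace X]
    [MeasurableSpace X] (ℙ : Measure Ω) (T : ℝ → ℝ → Ω → X → X)
    (G : ℝ → MeasurableSpace Ω) : Prop where
  cocycle : ∀ ω s r t, s ≤ r → r ≤ t → ∀ x, T t r ω (T r s ω x) = T t s ω x
  continuous : ∀ ω s t, s ≤ t → Continuous (T t s ω)
  le : ∀ r, G r ≤ mΩ
  anti : Antitone G
  measurable : ∀ s t, s ≤ t → ∀ x, Measurable[G s] fun ω => T t s ω x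
  indep : ∀ s r, s ≤ r → ∀ x,
    ProbabilityTheory.Indep (G r) (MeasurableSpace.comap (fun ω => T r s ω x) inferInstance) ℙ

namespace IsAdaptedFlow

variable {Ω X : Type*} [mΩ : MeasurableSpace Ω] [MetricSpace X]
  [TopologicalSpace.SeparableSpace X] [MeasurableSpace X] [BorelSpace X]
  {ℙ : Measure Ω} {T : ℝ → ℝ → Ω → X → X} {G : ℝ → MeasurableSpace Ω}

lemma measurable_uncurry_adapted (hT : IsAdaptedFlow ℙ T G) {s t : ℝ} (hst : s ≤ t) :
    Measurable[(G s).prod inferInstance] fun p : Ω × X => T t s p.1 p.2 :=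
  measurable_uncurry_of_forall_continuous (m := G s) (fun ω => hT.continuous ω s t hst)
    (hT.measurable s t hst)

lemma measurable_uncurry (hT : IsAdaptedFlow ℙ T G) {s t : ℝ} (hst : s ≤ t) :
    Measurable fun p : Ω × X => T t s p.1 p.2 :=
  measurable_uncurry_of_forall_continuous (fun ω => hT.continuous ω s t hst)
    fun x => (hT.measurable s t hst x).mono (hT.le s) le_rfl

lemma measurable_measure_preimage (hT : IsAdaptedFlow ℙ T G) {s t : ℝ} (hst : s ≤ t)
    (ν : Measure X) [SFinite ν] {B : Set X} (hB : MeasurableSet B) :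
    Measurable[G s] fun ω => ν (T t s ω ⁻¹' B) :=
  @measurable_measure_prodMk_left Ω X (G s) _ ν _ _ (hT.measurable_uncurry_adapted hst hB)

variable [IsProbabilityMeasure ℙ] {ρ : ℝ → Measure X}

lemma map_prod_eq (hT : IsAdaptedFlow ℙ T G) (hρ : IsMarkovEvolutionSystem ℙ T ρ) {s t : ℝ}
    (hst : s ≤ t) : ((ρ s).prod ℙ).map (fun p => T t s p.2 p.1) = ρ t := by
  have := hρ.1 s
  have hm : Measurable fun p : X × Ω => T t s p.2 p.1 :=
    (hT.measurable_uncurry hst).comp measurable_swap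
  ext B hB
  rw [Measure.map_apply hm hB, Measure.prod_apply (hm hB), ← hρ.2 s t hst B hB]
  rfl

lemma lintegral_measure_preimage (hT : IsAdaptedFlow ℙ T G) (hρ : IsMarkovEvolutionSystem ℙ T ρ)
    {s t : ℝ} (hst : s ≤ t) {B : Set X} (hB : MeasurableSet B) :
    ∫⁻ ω, ρ s (T t s ω ⁻¹' B) ∂ℙ = ρ t B := by
  have := hρ.1 s
  have hm : Measurable fun p : X × Ω => T t s p.2 p.1 :=
    (hT.measurable_uncurry hst).comp measurable_swap
  rw [← hT.map_prod_eq hρ hst, Measure.map_apply hm hB, Measure.prod_apply_symm (hm hB)]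
  rfl

/-- The martingale property of `s ↦ ρ s (T t s ω ⁻¹' B)` as `s` decreases. -/
lemma setLIntegral_measure_preimage (hT : IsAdaptedFlow ℙ T G)
    (hρ : IsMarkovEvolutionSystem ℙ T ρ) {s r t : ℝ} (hsr : s ≤ r) (hrt : r ≤ t)
    {A : Set Ω} (hA : MeasurableSet[G r] A) {B : Set X} (hB : MeasurableSet B) :
    ∫⁻ ω in A, ρ s (T t s ω ⁻¹' B) ∂ℙ = ∫⁻ ω in A, ρ r (T t r ω ⁻¹' B) ∂ℙ := by
  have := hρ.1 s
  have := hρ.1 r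
  have hA' : MeasurableSet A := hT.le r A hA
  have hφ {u : ℝ} (hut : u ≤ t) : Measurable fun p : Ω × X =>
      A.indicator 1 p.1 * B.indicator (1 : X → ENNReal) (T t u p.1 p.2) :=
    measurable_indicator_mul_indicator hA' hB (hT.measurable_uncurry hut)
  have hfub {u : ℝ} (hut : u ≤ t) [IsProbabilityMeasure (ρ u)] :
      ∫⁻ ω in A, ρ u (T t u ω ⁻¹' B) ∂ℙ
        = ∫⁻ x, ∫⁻ ω, A.indicator 1 ω * B.indicator 1 (T t u ω x) ∂ℙ ∂(ρ u) := by
    rw [← lintegral_lintegral_swap (hφ hut).aemeasurable, ← lintegral_indicator hA']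
    refine lintegral_congr fun ω => ?_
    have hmB : Measurable fun x => B.indicator (1 : X → ENNReal) (T t u ω x) :=
      (measurable_one.indicator hB).comp (hT.continuous ω u t hut).measurable
    rw [lintegral_const_mul _ hmB]
    have : ∫⁻ x, B.indicator (1 : X → ENNReal) (T t u ω x) ∂(ρ u) = ρ u (T t u ω ⁻¹' B) := by
      rw [← lintegral_indicator_one ((hT.continuous ω u t hut).measurable hB)]
      rfl
    rw [this]
    by_cases h : ω ∈ A <;> simp [h]
  have hm : Measurable fun p : X × Ω => T r s p.2 p.1 :=
    (hT.measurable_uncurry hsr).comp measurable_swap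
  have hh : Measurable fun x => ∫⁻ ω, A.indicator 1 ω * B.indicator 1 (T t r ω x) ∂ℙ :=
    (hφ hrt).lintegral_prod_left'
  have hhm : Measurable fun p : X × Ω =>
      ∫⁻ ω, A.indicator 1 ω * B.indicator 1 (T t r ω (T r s p.2 p.1)) ∂ℙ := hh.comp hm
  rw [hfub (hsr.trans hrt), hfub hrt, ← hT.map_prod_eq hρ hsr, lintegral_map hh hm,
    lintegral_prod _ hhm.aemeasurable]
  refine lintegral_congr fun x => ?_
  have hZ : Measurable fun ω => T r s ω x := (hT.measurable s r hsr x).mono (hT.le s) le_rfl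
  have hind : @ProbabilityTheory.IndepFun Ω Ω X mΩ (G r) _ id (fun ω => T r s ω x) ℙ := by
    refine (ProbabilityTheory.IndepFun_iff_Indep (mβ := G r) _ _ _).2 ?_
    rw [MeasurableSpace.comap_id]
    exact hT.indep s r hsr x
  have hφG : Measurable[(G r).prod inferInstance] fun p : Ω × X =>
      A.indicator 1 p.1 * B.indicator (1 : X → ENNReal) (T t r p.1 p.2) :=
    measurable_indicator_mul_indicator (m := G r) hA hB (hT.measurable_uncurry_adapted hrt)
  have key := @lintegral_comp_prodMk_of_indepFun Ω Ω X mΩ (G r) _ ℙ _ id (fun ω => T r s ω x)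
    (measurable_id'' (hT.le r)) hZ hind _ hφG
  simpa only [id, hT.cocycle _ s r t hsr hrt x] using key

/-- Along a decreasing sequence of initial times, the pulled-back mass of a fixed Borel set
converges almost surely. -/
lemma ae_exists_tendsto_of_antitone (hT : IsAdaptedFlow ℙ T G)
    (hρ : IsMarkovEvolutionSystem ℙ T ρ) {t : ℝ} {d : ℕ → ℝ} (hd : Antitone d)
    (hdt : ∀ n, d n ≤ t) {B : Set X} (hB : MeasurableSet B) :
    ∀ᵐ ω ∂ℙ, ∃ l, Tendsto (fun n => ρ (d n) (T t (d n) ω ⁻¹' B)) atTop (𝓝 l) := by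
  have := hρ.1
  let F : Filtration ℕ mΩ := ⟨fun n => G (d n), hT.anti.comp hd, fun n => hT.le _⟩
  let M : ℕ → Ω → ℝ := fun n ω => (ρ (d n)).real (T t (d n) ω ⁻¹' B)
  have hMG n : Measurable[F n] (M n) :=
    (hT.measurable_measure_preimage (hdt n) (ρ (d n)) hB).ennreal_toReal
  have hM n : Measurable (M n) := (hMG n).mono (hT.le _) le_rfl
  have hbd n ω : ‖M n ω‖ ≤ 1 := by
    rw [Real.norm_of_nonneg measureReal_nonneg]
    exact measureReal_le_one
  have hmart : Martingale M F ℙ := by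
    refine martingale_of_setIntegral_eq_succ (fun n => (hMG n).stronglyMeasurable)
      (fun n => Integrable.of_bound (hM n).aestronglyMeasurable 1 (ae_of_all _ (hbd n)))
      fun n A hA => ?_
    have hreal k : ∫ ω in A, M k ω ∂ℙ
        = (∫⁻ ω in A, ρ (d k) (T t (d k) ω ⁻¹' B) ∂ℙ).toReal :=
      integral_toReal ((hT.measurable_measure_preimage (hdt k) (ρ (d k)) hB).mono
        (hT.le _) le_rfl).aemeasurable (ae_of_all _ fun ω => measure_lt_top _ _)
    rw [hreal, hreal, hT.setLIntegral_measure_preimage hρ (hd n.le_succ) (hdt n) hA hB]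
  have hlim := hmart.submartingale.ae_tendsto_limitProcess (R := 1) fun n => by
    refine (eLpNorm_le_of_ae_bound (C := 1) (ae_of_all _ (hbd n))).trans ?_
    simp
  filter_upwards [hlim] with ω hω
  refine ⟨_, (ENNReal.tendsto_ofReal hω).congr fun n => ?_⟩
  simp [M]

end IsAdaptedFlow

/-- A sequence of probability measures on a Polish space is tight as soon as the asymptotic mass of
the complements of some sequence of compact sets tends to zero. -/
lemma isTightMeasureSet_range_of_tendsto_liminf {X : Type*} [MetricSpace X] [CompleteSpace X]
    [SecondCountableTopology X] [MeasurableSpace X] [BorelSpace X] {ν : ℕ → Measure X}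
    [∀ n, IsFiniteMeasure (ν n)] {K : ℕ → Set X} (hK : ∀ m, IsCompact (K m))
    (hlim : ∀ m, ∃ l, Tendsto (fun n => ν n (K m)ᶜ) atTop (𝓝 l))
    (hzero : Tendsto (fun m => liminf (fun n => ν n (K m)ᶜ) atTop) atTop (𝓝 0)) :
    IsTightMeasureSet (Set.range ν) := by
  rw [isTightMeasureSet_iff_exists_isCompact_measure_compl_le]
  intro ε hε
  obtain ⟨m, hm⟩ := (hzero.eventually_lt_const hε).exists
  obtain ⟨l, hl⟩ := hlim m
  rw [hl.liminf_eq] at hm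
  obtain ⟨N, hN⟩ := eventually_atTop.1 (hl.eventually_lt_const hm)
  have hC n : ∃ C, IsCompact C ∧ ν n Cᶜ ≤ ε := by
    simpa using isTightMeasureSet_iff_exists_isCompact_measure_compl_le.1
      (isTightMeasureSet_singleton (μ := ν n)) ε hε
  choose C hC hCε using hC
  refine ⟨K m ∪ ⋃ n ∈ Finset.range N, C n,
    (hK m).union ((Finset.range N).isCompact_biUnion fun n _ => hC n), ?_⟩
  rintro _ ⟨n, rfl⟩
  rcases lt_or_ge n N with h | h
  · refine (measure_mono (Set.compl_subset_compl.2 ?_)).trans (hCε n)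
    exact Set.subset_union_of_subset_right
      (Set.subset_biUnion_of_mem (u := C) (Finset.mem_coe.2 (Finset.mem_range.2 h))) _
  · exact (measure_mono (Set.compl_subset_compl.2 Set.subset_union_left)).trans (hN n h).le

/-- A tight sequence of probability measures whose values on all finite unions of basic open sets
converge is weakly convergent. -/
lemma ProbabilityMeasure.exists_tendsto_of_isTightMeasureSet {X : Type*} [MetricSpace X]
    [SecondCountableTopology X] [MeasurableSpace X] [BorelSpace X] {ν : ℕ → ProbabilityMeasure X}
    (htight : IsTightMeasureSet (Set.range fun n => (ν n : Measure X)))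
    (hlim : ∀ U ∈ {F | F.Finite ∧ F ⊆ TopologicalSpace.countableBasis X},
      ∃ l, Tendsto (fun n => (ν n : Measure X) (⋃₀ U)) atTop (𝓝 l)) :
    ∃ μ, Tendsto ν atTop (𝓝 μ) := by
  have hcomp : IsCompact (closure (Set.range ν)) := by
    refine isCompact_closure_of_isTightMeasureSet (htight.subset ?_)
    rintro _ ⟨_, ⟨n, rfl⟩, rfl⟩
    exact ⟨n, rfl⟩
  obtain ⟨μ, -, φ, hφ, hμ⟩ := hcomp.tendsto_subseq fun n => subset_closure (Set.mem_range_self n)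
  have hbasis := TopologicalSpace.isBasis_countableBasis X
  refine ⟨μ, tendsto_of_forall_isOpen_le_liminf' fun G hG => ?_⟩
  refine le_of_forall_lt fun r hr => ?_
  lift r to NNReal using hr.ne_top
  obtain ⟨F, hF, hrF, hFG⟩ := μ.exists_lt_measure_biUnion_of_isOpen
    (S := TopologicalSpace.countableBasis X) (r := r)
    (fun u hu x hx => by
      obtain ⟨v, hv, hxv, hvu⟩ := hbasis.exists_subset_of_mem_open hx hu
      exact ⟨v, hv, (hbasis.isOpen hv).mem_nhds hxv, hvu⟩) hG
    (by rw [← ENNReal.coe_lt_coe]; simpa using hr)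
  have hU : ⋃ t ∈ F, t = ⋃₀ (F : Set (Set X)) := by simp [Set.sUnion_eq_biUnion]
  rw [hU] at hrF hFG
  obtain ⟨l, hl⟩ := hlim (F : Set (Set X)) ⟨F.finite_toSet, fun s hs => hF s hs⟩
  have hopen : IsOpen (⋃₀ (F : Set (Set X))) := isOpen_sUnion fun s hs => hbasis.isOpen (hF s hs)
  calc (r : ENNReal) < (μ : Measure X) (⋃₀ (F : Set (Set X))) := by
        rw [← ENNReal.coe_lt_coe] at hrF; simpa using hrF
    _ ≤ liminf (fun n => (ν (φ n) : Measure X) (⋃₀ (F : Set (Set X)))) atTop :=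
        ProbabilityMeasure.le_liminf_measure_open_of_tendsto hμ hopen
    _ = liminf (fun n => (ν n : Measure X) (⋃₀ (F : Set (Set X)))) atTop := by
        rw [hl.liminf_eq]; exact (hl.comp hφ.tendsto_atTop).liminf_eq
    _ ≤ liminf (fun n => (ν n : Measure X) G) atTop :=
        liminf_le_liminf (Eventually.of_forall fun n => measure_mono hFG)

/-- An everywhere weak limit of random probability measures is a random probability measure. -/
lemma measurable_of_forall_tendsto_probabilityMeasure {Ω X : Type*} [MeasurableSpace Ω]
    [MetricSpace X] [MeasurableSpace X] [BorelSpace X] {ν : ℕ → Ω → ProbabilityMeasure X}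
    {μ : Ω → ProbabilityMeasure X} (hν : ∀ n, Measurable fun ω => (ν n ω : Measure X))
    (h : ∀ ω, Tendsto (fun n => ν n ω) atTop (𝓝 (μ ω))) :
    Measurable fun ω => (μ ω : Measure X) := by
  refine Measurable.measure_of_isPiSystem_of_isProbabilityMeasure
    ((BorelSpace.measurable_eq).trans borel_eq_generateFrom_isClosed) isPiSystem_isClosed
    fun F hF => ?_
  refine measurable_of_tendsto_metrizable
    (f := fun k ω => ∫⁻ x, (hF.apprSeq k) x ∂(μ ω : Measure X))
    (fun k => ?_) (tendsto_pi_nhds.2 fun ω =>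
      HasOuterApproxClosed.tendsto_lintegral_apprSeq hF (μ ω : Measure X))
  refine measurable_of_tendsto_metrizable
    (f := fun n ω => ∫⁻ x, (hF.apprSeq k) x ∂(ν n ω : Measure X))
    (fun n => ?_) (tendsto_pi_nhds.2 fun ω =>
      ProbabilityMeasure.tendsto_iff_forall_lintegral_tendsto.1 (h ω) (hF.apprSeq k))
  exact (Measure.measurable_lintegral (by fun_prop)).comp (hν n)

/-- A sequence tending to infinity in an unbounded linear order factors through a monotone sequence
and an index that tends to infinity. -/
lemma Filter.Tendsto.exists_monotone_comp_eq {α : Type*} [LinearOrder α] [NoMaxOrder α]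
    {s : ℕ → α} (hs : Tendsto s atTop atTop) :
    ∃ (d : ℕ → α) (k : ℕ → ℕ), Monotone d ∧ Tendsto k atTop atTop ∧ (∀ n, d (k n) = s n) ∧
      ∀ j, d j ∈ Set.range s := by
  have hfin b : {n | s n ≤ b}.Finite := by
    obtain ⟨N, hN⟩ := eventually_atTop.1 (hs.eventually_gt_atTop b)
    exact (Set.finite_lt_nat N).subset fun n hn => not_le.1 fun h => (hN n h).not_ge hn
  let ι := Set.range s
  let _ : LocallyFiniteOrder ι := LocallyFiniteOrder.ofFiniteIcc fun a b => by
    refine ((hfin b).image fun n => (⟨s n, n, rfl⟩ : ι)).subset ?_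
    rintro ⟨_, n, rfl⟩ hn
    exact ⟨n, hn.2, rfl⟩
  have : NoMaxOrder ι := ⟨fun a => by
    obtain ⟨n, hn⟩ := (hs.eventually_gt_atTop (a : α)).exists
    exact ⟨⟨s n, n, rfl⟩, hn⟩⟩
  obtain ⟨n₀, -, hn₀⟩ := Set.exists_min_image _ s (hfin (s 0)) ⟨0, le_rfl⟩
  let _ : OrderBot ι :=
    { bot := ⟨s n₀, n₀, rfl⟩
      bot_le := by
        rintro ⟨_, n, rfl⟩
        rcases le_total (s n) (s 0) with h | h
        · exact hn₀ n h
        · exact (hn₀ 0 le_rfl).trans h }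
  let _ : SuccOrder ι := LinearLocallyFiniteOrder.succOrder ι
  let _ : PredOrder ι := LinearLocallyFiniteOrder.predOrder ι
  let e : ι ≃o ℕ := orderIsoNatOfLinearSuccPredArch
  refine ⟨fun j => e.symm j, fun n => e ⟨s n, n, rfl⟩, fun i j h => e.symm.monotone h, ?_,
    fun n => by simp, fun j => (e.symm j).2⟩
  refine tendsto_atTop.2 fun j => ?_
  filter_upwards [hs.eventually_ge_atTop (e.symm j : α)] with n hn
  have : e.symm j ≤ ⟨s n, n, rfl⟩ := hn
  simpa using e.monotone this

namespace IsAdaptedFlow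

variable {Ω X : Type*} [mΩ : MeasurableSpace Ω] [MetricSpace X]
  [TopologicalSpace.SeparableSpace X] [MeasurableSpace X] [BorelSpace X]
  {ℙ : Measure Ω} [IsProbabilityMeasure ℙ] {T : ℝ → ℝ → Ω → X → X} {G : ℝ → MeasurableSpace Ω}
  {ρ : ℝ → Measure X} {t : ℝ} {s : ℕ → ℝ}

/-- The pulled-back mass of a fixed Borel set converges almost surely along any sequence of initial
times that tends to `-∞`. -/
lemma ae_exists_tendsto (hT : IsAdaptedFlow ℙ T G) (hρ : IsMarkovEvolutionSystem ℙ T ρ)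
    (hs : Tendsto s atTop atBot) (hst : ∀ n, s n ≤ t) {B : Set X} (hB : MeasurableSet B) :
    ∀ᵐ ω ∂ℙ, ∃ l, Tendsto (fun n => ρ (s n) (T t (s n) ω ⁻¹' B)) atTop (𝓝 l) := by
  have hs' : Tendsto (OrderDual.toDual ∘ s) atTop atTop := hs
  obtain ⟨d, k, hd, hk, hdk, hds⟩ := hs'.exists_monotone_comp_eq
  have hdt j : OrderDual.ofDual (d j) ≤ t := by
    obtain ⟨n, hn⟩ := hds j
    rw [← hn]
    exact hst n
  filter_upwards [hT.ae_exists_tendsto_of_antitone hρ (d := OrderDual.ofDual ∘ d)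
    (fun i j h => hd h) hdt hB] with ω ⟨l, hl⟩
  refine ⟨l, (hl.comp hk).congr fun n => ?_⟩
  simp only [Function.comp_apply, hdk, OrderDual.ofDual_toDual]

omit [TopologicalSpace.SeparableSpace X] [IsProbabilityMeasure ℙ] in
lemma map_apply (hT : IsAdaptedFlow ℙ T G) {r : ℝ} (hrt : r ≤ t) (ν : Measure X) (ω : Ω)
    {B : Set X} (hB : MeasurableSet B) : ν.map (T t r ω) B = ν (T t r ω ⁻¹' B) :=
  Measure.map_apply (hT.continuous ω r t hrt).measurable hB

omit [IsProbabilityMeasure ℙ] in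
lemma measurable_map (hT : IsAdaptedFlow ℙ T G) {r : ℝ} (hrt : r ≤ t) (ν : Measure X) [SFinite ν] :
    Measurable fun ω => ν.map (T t r ω) := by
  refine Measure.measurable_of_measurable_coe _ fun B hB => ?_
  simp only [hT.map_apply hrt ν _ hB]
  exact (hT.measurable_measure_preimage hrt ν hB).mono (hT.le r) le_rfl

/-- The pushforwards along the flow of an evolution system of measures converge weakly, almost
surely, along any sequence of initial times that tends to `-∞`. -/
lemma ae_exists_tendsto_map [CompleteSpace X] (hT : IsAdaptedFlow ℙ T G)
    (hρ : IsMarkovEvolutionSystem ℙ T ρ) (hs : Tendsto s atTop atBot) (hst : ∀ n, s n ≤ t)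
    {ν : ℕ → Ω → ProbabilityMeasure X}
    (hν : ∀ n ω, (ν n ω : Measure X) = (ρ (s n)).map (T t (s n) ω)) :
    ∀ᵐ ω ∂ℙ, ∃ μ, Tendsto (fun n => ν n ω) atTop (𝓝 μ) := by
  have := UniformSpace.secondCountable_of_separable X
  have := hρ.1
  have hνB n ω {B : Set X} (hB : MeasurableSet B) :
      (ν n ω : Measure X) B = ρ (s n) (T t (s n) ω ⁻¹' B) := by
    rw [hν, hT.map_apply (hst n) _ _ hB]
  have hνm n {B : Set X} (hB : MeasurableSet B) : Measurable fun ω => (ν n ω : Measure X) B := by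
    simp only [hνB n _ hB]
    exact (hT.measurable_measure_preimage (hst n) _ hB).mono (hT.le _) le_rfl
  have hlim {B : Set X} (hB : MeasurableSet B) :
      ∀ᵐ ω ∂ℙ, ∃ l, Tendsto (fun n => (ν n ω : Measure X) B) atTop (𝓝 l) := by
    simp only [hνB _ _ hB]
    exact hT.ae_exists_tendsto hρ hs hst hB
  obtain ⟨ε, hε, hεsum⟩ := ENNReal.exists_pos_sum_of_countable (ε := 1) one_ne_zero ℕ
  have hK m : ∃ K, IsCompact K ∧ ρ t Kᶜ ≤ ε m := by
    simpa using isTightMeasureSet_iff_exists_isCompact_measure_compl_le.1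
      (isTightMeasureSet_singleton (μ := ρ t)) (ε m) (by simpa using hε m)
  choose K hK hKε using hK
  have hKm m : MeasurableSet (K m)ᶜ := (hK m).measurableSet.compl
  have hLm m : Measurable fun ω => liminf (fun n => (ν n ω : Measure X) (K m)ᶜ) atTop :=
    .liminf fun n => hνm n (hKm m)
  have hL m : ∫⁻ ω, liminf (fun n => (ν n ω : Measure X) (K m)ᶜ) atTop ∂ℙ ≤ ε m := by
    refine (lintegral_liminf_le fun n => hνm n (hKm m)).trans (le_trans ?_ (hKε m))
    simp only [hνB _ _ (hKm m), hT.lintegral_measure_preimage hρ (hst _) (hKm m), liminf_const,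
      le_refl]
  have hzero : ∀ᵐ ω ∂ℙ,
      Tendsto (fun m => liminf (fun n => (ν n ω : Measure X) (K m)ᶜ) atTop) atTop (𝓝 0) := by
    have hsum : ∫⁻ ω, ∑' m, liminf (fun n => (ν n ω : Measure X) (K m)ᶜ) atTop ∂ℙ ≠ ⊤ := by
      rw [lintegral_tsum fun m => (hLm m).aemeasurable]
      exact ((ENNReal.tsum_le_tsum hL).trans_lt (hεsum.trans ENNReal.one_lt_top)).ne
    filter_upwards [ae_lt_top (Measurable.tsum hLm) hsum] with ω hω
    exact ENNReal.tendsto_atTop_zero_of_tsum_ne_top hω.ne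
  have hU := (ae_ball_iff (μ := ℙ) (Set.countable_ofPred_finite_subset
      (TopologicalSpace.countable_countableBasis X))
    (p := fun ω U _ => ∃ l, Tendsto (fun n => (ν n ω : Measure X) (⋃₀ U)) atTop (𝓝 l))).2
    fun U hU => hlim (isOpen_sUnion fun u hu =>
      (TopologicalSpace.isBasis_countableBasis X).isOpen (hU.2 hu)).measurableSet
  filter_upwards [hzero, ae_all_iff.2 fun m => hlim (hKm m), hU] with ω h0 hlimω hUω
  exact ProbabilityMeasure.exists_tendsto_of_isTightMeasureSet
    (isTightMeasureSet_range_of_tendsto_liminf hK hlimω h0) hUω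

/-- There is a random probability measure to which the pushforwards along the flow of an evolution
system of measures converge weakly, almost surely, along every sequence of initial times that tends
to `-∞`. -/
lemma exists_measurable_forall_ae_tendsto [CompleteSpace X] (hT : IsAdaptedFlow ℙ T G)
    (hρ : IsMarkovEvolutionSystem ℙ T ρ) (t : ℝ) :
    ∃ μ : Ω → ProbabilityMeasure X, (Measurable fun ω => (μ ω : Measure X)) ∧
      ∀ s : ℕ → ℝ, Tendsto s atTop atBot → ∀ᵐ ω ∂ℙ, ∀ f : BoundedContinuousFunction X ℝ,
        Tendsto (fun n => ∫ x, f x ∂((ρ (s n)).map (T t (s n) ω))) atTop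
          (𝓝 (∫ x, f x ∂(μ ω : Measure X))) := by
  have := hρ.1
  let ν (r : ℝ) (ω : Ω) : ProbabilityMeasure X :=
    ⟨(ρ (min r t)).map (T t (min r t) ω), Measure.isProbabilityMeasure_map
      (hT.continuous ω _ t (min_le_right r t)).measurable.aemeasurable⟩
  have hν {s : ℕ → ℝ} (hs : Tendsto s atTop atBot) :
      ∀ᵐ ω ∂ℙ, ∃ μ, Tendsto (fun n => ν (s n) ω) atTop (𝓝 μ) :=
    hT.ae_exists_tendsto_map hρ (tendsto_atBot_mono (fun n => min_le_left _ t) hs)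
      (fun n => min_le_right _ t) fun n ω => rfl
  let b : ℕ → ℝ := fun n => -n
  have hb : Tendsto b atTop atBot := tendsto_neg_atTop_atBot.comp tendsto_natCast_atTop_atTop
  obtain ⟨E, hEae, hE, hEsub⟩ := (hν hb).exists_measurable_mem
  classical
  let ν' (n : ℕ) (ω : Ω) : ProbabilityMeasure X := if ω ∈ E then ν (b n) ω else ⟨ρ 0, hρ.1 0⟩
  have hν' ω : ∃ μ, Tendsto (fun n => ν' n ω) atTop (𝓝 μ) := by
    by_cases h : ω ∈ E
    · simpa [ν', h] using hEsub ω h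
    · simp only [ν', h]
      exact ⟨_, tendsto_const_nhds⟩
  choose μ hμ using hν'
  refine ⟨μ, measurable_of_forall_tendsto_probabilityMeasure (fun n => ?_) hμ, fun s hs => ?_⟩
  · have : (fun ω => (ν' n ω : Measure X)) = fun ω =>
        if ω ∈ E then (ρ (min (b n) t)).map (T t (min (b n) t) ω) else ρ 0 := by
      ext1 ω
      by_cases h : ω ∈ E <;> simp [ν', h, ν]
    rw [this]
    exact Measurable.ite hE (hT.measurable_map (min_le_right _ t) _) measurable_const
  · let u : ℕ → ℝ := fun n => if Even n then s (n / 2) else b (n / 2)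
    have hdiv : Tendsto (fun n : ℕ => n / 2) atTop atTop :=
      Nat.tendsto_div_const_atTop two_ne_zero
    have hu : Tendsto u atTop atBot := (hs.comp hdiv).if' (hb.comp hdiv)
    have hst : ∀ᶠ n in atTop, s n ≤ t := hs.eventually_le_atBot t
    filter_upwards [hν hu, hEae] with ω ⟨η, hη⟩ hωE
    have hηs : Tendsto (fun n => ν (s n) ω) atTop (𝓝 η) :=
      (hη.comp (tendsto_id.const_mul_atTop' (two_pos : 0 < 2))).congr fun n => by simp [u]
    have hηb : Tendsto (fun n => ν (b n) ω) atTop (𝓝 η) := by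
      refine (hη.comp (tendsto_atTop_mono (fun n => (by omega : n ≤ 2 * n + 1))
        tendsto_id)).congr fun n => ?_
      have h2 : (2 * n + 1) / 2 = n := by omega
      simp [u, h2]
    have hμη : μ ω = η := tendsto_nhds_unique (hμ ω) (by simpa [ν', show ω ∈ E from hωE] using hηb)
    rw [hμη]
    intro f
    refine (ProbabilityMeasure.tendsto_iff_forall_integral_tendsto.1 hηs f).congr' ?_
    filter_upwards [hst] with n hn
    simp [ν, min_eq_left hn]

end IsAdaptedFlow

lemma completionOf_mono {Ω : Type*} {m m' : MeasurableSpace Ω} [MeasurableSpace Ω] (ℙ : Measure Ω)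
    (h : m ≤ m') : completionOf ℙ m ≤ completionOf ℙ m' :=
  MeasurableSpace.generateFrom_mono fun _ ⟨B, hB, hAB⟩ => ⟨B, h B hB, hAB⟩

lemma measurableSet_completionOf_of_ae_eq {Ω : Type*} {m : MeasurableSpace Ω} [MeasurableSpace Ω]
    {ℙ : Measure Ω} {A B : Set Ω} (hB : MeasurableSet[m] B) (hAB : A =ᵐ[ℙ] B) :
    MeasurableSet[completionOf ℙ m] A :=
  MeasurableSpace.measurableSet_generateFrom ⟨B, hB, measure_symmDiff_eq_zero_iff.2 hAB⟩

lemma Fge_antitone {Ω X : Type*} [MeasurableSpace Ω] [MeasurableSpace X] (ℙ : Measure Ω)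
    (S : ℝ → ℝ → Ω → X → X) : Antitone (Fge ℙ S) := fun _ _ h =>
  completionOf_mono ℙ <| MeasurableSpace.generateFrom_mono
    fun _ ⟨t, u, x, B, ht, hu, hB, hA⟩ => ⟨t, u, x, B, h.trans ht, hu, hB, hA⟩

/-- A white noise flow has a modification that satisfies the defining properties everywhere. -/
lemma IsWhiteNoiseFlow.exists_isAdaptedFlow {Ω X : Type*} [mΩ : MeasurableSpace Ω] [MetricSpace X]
    [MeasurableSpace X] [BorelSpace X] {ℙ : Measure Ω} {S : ℝ → ℝ → Ω → X → X}
    (hS : IsWhiteNoiseFlow ℙ S) :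
    ∃ (T : ℝ → ℝ → Ω → X → X) (G : ℝ → MeasurableSpace Ω), IsAdaptedFlow ℙ T G ∧
      ∀ᵐ ω ∂ℙ, ∀ t s, T t s ω = S t s ω := by
  classical
  obtain ⟨E, hEae, hE, hES⟩ := hS.1.1.exists_measurable_mem
  let T (t s : ℝ) (ω : Ω) (x : X) : X := if ω ∈ E then S t s ω x else x
  have hTS : ∀ᵐ ω ∂ℙ, ∀ t s, T t s ω = S t s ω := by
    filter_upwards [hEae] with ω hω t s
    ext x
    simp [T, hω]
  have hpre (t s : ℝ) (x : X) (C : Set X) : {ω | T t s ω x ∈ C} =ᵐ[ℙ] {ω | S t s ω x ∈ C} := by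
    filter_upwards [hTS] with ω hω
    exact congrArg (· x ∈ C) (hω t s)
  refine ⟨T, fun r => Fge ℙ S r ⊓ mΩ,
    { cocycle := fun ω s r t hsr hrt x => ?_
      continuous := fun ω s t hst => ?_
      le := fun r => inf_le_right
      anti := fun r r' h => inf_le_inf_right _ (Fge_antitone ℙ S h)
      measurable := fun s t hst x C hC => MeasurableSpace.measurableSet_inf.2 ⟨?_, ?_⟩
      indep := fun s r hsr x => ?_ }, hTS⟩
  · by_cases h : ω ∈ E
    · simpa [T, h] using (hES ω h).1 s r t hsr hrt x
    · simp [T, h]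
  · by_cases h : ω ∈ E
    · simpa [T, h] using (hES ω h).2.1 s t hst
    · simpa [T, h] using continuous_id'
  · exact measurableSet_completionOf_of_ae_eq
      (MeasurableSpace.measurableSet_generateFrom ⟨s, t, x, C, le_rfl, hst, hC, rfl⟩) (hpre t s x C)
  · have hSm : Measurable fun ω => S t s ω x :=
      (hS.1.2 t x).comp (measurable_const.prodMk measurable_id :
        Measurable fun ω : Ω => ((⟨s, hst⟩ : {s : ℝ // s ≤ t}), ω))
    exact (Measurable.ite hE hSm measurable_const : Measurable fun ω => T t s ω x) hC
  · refine ProbabilityTheory.indep_of_indep_of_le_left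
      (ProbabilityTheory.indep_of_indep_of_le_right (hS.2 r) ?_) inf_le_left
    rintro _ ⟨C, hC, rfl⟩
    exact measurableSet_completionOf_of_ae_eq
      (MeasurableSpace.measurableSet_generateFrom ⟨s, r, x, C, hsr, le_rfl, hC, rfl⟩) (hpre r s x C)

lemma IsMarkovEvolutionSystem.congr {Ω X : Type*} [MeasurableSpace Ω] [MeasurableSpace X]
    {ℙ : Measure Ω} {S T : ℝ → ℝ → Ω → X → X} {ρ : ℝ → Measure X}
    (hρ : IsMarkovEvolutionSystem ℙ S ρ) (hTS : ∀ᵐ ω ∂ℙ, ∀ t s, T t s ω = S t s ω) :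
    IsMarkovEvolutionSystem ℙ T ρ := by
  refine ⟨hρ.1, fun s t hst B hB => (lintegral_congr fun x => ?_).trans (hρ.2 s t hst B hB)⟩
  refine measure_congr ?_
  filter_upwards [hTS] with ω hω
  exact congrArg (· x ∈ B) (hω t s)

/-- for a white noise stochastic flow `S` with evolution system of measures
`ρ` for the Markov semigroup and fixed `t`, there is a random probability measure
`ω ↦ μ_ω` on `X` such that for every deterministic sequence `s_n → -∞`, the pushforwards
`S(t,s_n;ω) ρ_{s_n}` converge weakly to `μ_ω` for `ℙ`-a.e. `ω` (in particular, a.s. the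
limit does not depend on the sequence). -/
theorem stmt10 {Ω X : Type*} [MeasurableSpace Ω] [MetricSpace X] [CompleteSpace X]
    [TopologicalSpace.SeparableSpace X] [MeasurableSpace X] [BorelSpace X]
    (ℙ : Measure Ω) [IsProbabilityMeasure ℙ]
    (S : ℝ → ℝ → Ω → X → X) (hS : IsWhiteNoiseFlow ℙ S)
    (ρ : ℝ → Measure X) (hρ : IsMarkovEvolutionSystem ℙ S ρ)
    (t : ℝ) :
    ∃ μ : Ω → Measure X,
      (∀ ω : Ω, IsProbabilityMeasure (μ ω)) ∧
      (∀ B : Set X, MeasurableSet B → Measurable fun ω => μ ω B) ∧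
      (∀ s : ℕ → ℝ, Tendsto s atTop atBot →
        ∀ᵐ ω ∂ℙ, ∀ f : BoundedContinuousFunction X ℝ,
          Tendsto (fun n => ∫ x, f x ∂((ρ (s n)).map (S t (s n) ω))) atTop
            (𝓝 (∫ x, f x ∂(μ ω)))) := by
  obtain ⟨T, G, hT, hTS⟩ := hS.exists_isAdaptedFlow
  obtain ⟨μ, hμ, hlim⟩ := hT.exists_measurable_forall_ae_tendsto (hρ.congr hTS) t
  refine ⟨fun ω => μ ω, fun ω => inferInstance, fun B hB => (Measure.measurable_coe hB).comp hμ,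
    fun s hs => ?_⟩
  filter_upwards [hlim s hs, hTS] with ω hω hTSω
  simpa only [hTSω] using hω
end

section
/- Let S be a white noise stochastic flow on a Polish space X with Markov semigroup P_{st}f(x) := 𝔼[f(S(t,s;·)x)], and let {ρ_s}_{s∈ℝ} be an evolution system of measures for {P_{st}}. For each t ∈ ℝ let μ_{tω} := lim_{s→−∞} S(t,s;ω)ρ_s, the ℙ-a.s. weak limit along deterministic sequences of the pushforwards of ρ_s under x ↦ S(t,s;ω)x. Then: (i) the family {μ_t}_{t∈ℝ}, given by μ_t(A×B) = ∫_A μ_{tω}(B) dℙ(ω), is an evolution system of measures for S; (ii) for each t ∈ ℝ and each Borel B ⊆ X, the map ω ↦ μ_{tω}(B) is measurable with respect to 𝓕_{≤t}; (iii) 𝔼[μ_{tω}(B)] = ρ_t(B) for all t ∈ ℝ and all Borel B ⊆ X. -/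
open MeasureTheory Filter Topology

section Kernels

open ProbabilityTheory

/-- A family of probability measures is measurable as soon as the integrals of bounded
continuous functions are. -/
theorem measurable_of_measurable_integral_boundedContinuousFunction {Ω X : Type*}
    [MeasurableSpace Ω] [MetricSpace X] [MeasurableSpace X] [BorelSpace X]
    {κ : Ω → Measure X} (hκ : ∀ ω, IsProbabilityMeasure (κ ω))
    (h : ∀ f : BoundedContinuousFunction X ℝ, Measurable fun ω => ∫ x, f x ∂(κ ω)) :
    Measurable κ := by
  refine Measurable.measure_of_isPiSystem_of_isProbabilityMeasure
    (BorelSpace.measurable_eq.trans borel_eq_generateFrom_isClosed) isPiSystem_isClosed ?_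
  intro F hF
  have hpos : ∀ n : ℕ, (0 : ℝ) < 1 / ((n : ℝ) + 1) := fun n => Nat.one_div_pos_of_nat
  have hlim := fun ω => tendsto_lintegral_thickenedIndicator_of_isClosed (κ ω) hF hpos
    tendsto_one_div_add_atTop_nhds_zero_nat
  refine measurable_of_tendsto_metrizable (fun n => ?_) (tendsto_pi_nhds.2 hlim)
  have hint : ∀ ω, ∫⁻ x, (thickenedIndicator (hpos n) F x : ENNReal) ∂(κ ω) =
      ENNReal.ofReal (∫ x, ((thickenedIndicator (hpos n) F x : NNReal) : ℝ) ∂(κ ω)) := fun ω =>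
    lintegral_coe_eq_integral _ (integrable_thickenedIndicator F (hpos n))
  simp_rw [hint]
  exact (h ⟨⟨fun x => ((thickenedIndicator (hpos n) F x : NNReal) : ℝ),
    NNReal.continuous_coe.comp (thickenedIndicator (hpos n) F).continuous⟩,
    (thickenedIndicator (hpos n) F).map_bounded'⟩).ennreal_ofReal

/-- A pointwise weak limit of images of fixed probability measures under random continuous maps
is a measurable family of measures. -/
theorem measurable_of_tendsto_integral_comp {Ω X : Type*}
    [MeasurableSpace Ω] [MetricSpace X] [SecondCountableTopology X] [MeasurableSpace X]
    [BorelSpace X] {κ : Ω → Measure X} (hκ : ∀ ω, IsProbabilityMeasure (κ ω))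
    {φ : ℕ → Ω → X → X} (hφm : ∀ n x, Measurable fun ω => φ n ω x)
    (hφc : ∀ n ω, Continuous (φ n ω))
    {ν : ℕ → Measure X} (hν : ∀ n, IsProbabilityMeasure (ν n))
    (hlim : ∀ ω (f : BoundedContinuousFunction X ℝ),
      Tendsto (fun n => ∫ x, f (φ n ω x) ∂(ν n)) atTop (𝓝 (∫ x, f x ∂(κ ω)))) :
    Measurable κ := by
  refine measurable_of_measurable_integral_boundedContinuousFunction hκ fun f => ?_
  refine measurable_of_tendsto_metrizable (fun n => ?_) (tendsto_pi_nhds.2 fun ω => hlim ω f)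
  have hjoint : Measurable fun p : Ω × X => f (φ n p.1 p.2) :=
    f.continuous.measurable.comp ((measurable_uncurry_of_continuous_of_measurable
      (u := fun x ω => φ n ω x) (hφc n) (hφm n)).comp measurable_swap)
  exact hjoint.stronglyMeasurable.integral_prod_right'.measurable

/-- Mean value of a measurable weak limit of random images of measures whose averages are all
equal to `ρ`. -/
theorem lintegral_limit_eq {Ω X : Type*}
    [MeasurableSpace Ω] [MetricSpace X] [SecondCountableTopology X] [MeasurableSpace X]
    [BorelSpace X] (P : Measure Ω) [IsProbabilityMeasure P]
    {κ : Ω → Measure X} (hκ : ∀ ω, IsProbabilityMeasure (κ ω)) (hκm : Measurable κ)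
    {φ : ℕ → Ω → X → X} (hφm : ∀ n x, Measurable fun ω => φ n ω x)
    (hφc : ∀ n ω, Continuous (φ n ω))
    {ν : ℕ → Measure X} (hν : ∀ n, IsProbabilityMeasure (ν n))
    (hlim : ∀ᵐ ω ∂P, ∀ f : BoundedContinuousFunction X ℝ,
      Tendsto (fun n => ∫ x, f (φ n ω x) ∂(ν n)) atTop (𝓝 (∫ x, f x ∂(κ ω))))
    (ρ : Measure X) [IsProbabilityMeasure ρ]
    (hρ : ∀ n (B : Set X), MeasurableSet B → (∫⁻ x, P {ω | φ n ω x ∈ B} ∂(ν n)) = ρ B)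
    {B : Set X} (hB : MeasurableSet B) : (∫⁻ ω, κ ω B ∂P) = ρ B := by
  have hjoint : ∀ n, Measurable fun p : Ω × X => φ n p.1 p.2 := fun n =>
    (measurable_uncurry_of_continuous_of_measurable
      (u := fun x ω => φ n ω x) (hφc n) (hφm n)).comp measurable_swap
  have hmap : ∀ n, (P.prod (ν n)).map (fun p : Ω × X => φ n p.1 p.2) = ρ := by
    intro n
    ext A hA
    rw [Measure.map_apply (hjoint n) hA, Measure.prod_apply_symm (hjoint n hA), ← hρ n A hA]
    rfl
  let K : Kernel Ω X := ⟨κ, hκm⟩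
  have : IsMarkovKernel K := ⟨hκ⟩
  have hmean : (P ⊗ₘ K).snd = ρ := by
    refine ext_of_forall_integral_eq_of_IsFiniteMeasure fun f => ?_
    have hbound : ∀ x, ‖f x‖ ≤ ‖f‖ := f.norm_coe_le_norm
    have h₁ : ∀ n, ∫ ω, ∫ x, f (φ n ω x) ∂(ν n) ∂P = ∫ x, f x ∂ρ := by
      intro n
      rw [← hmap n, integral_map (hjoint n).aemeasurable
        f.continuous.measurable.aestronglyMeasurable]
      refine (integral_prod (fun p : Ω × X => f (φ n p.1 p.2)) ?_).symm
      exact Integrable.of_bound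
        (f.continuous.measurable.comp (hjoint n)).aestronglyMeasurable ‖f‖
        (Eventually.of_forall fun p => hbound _)
    have h₂ : Tendsto (fun n => ∫ ω, ∫ x, f (φ n ω x) ∂(ν n) ∂P) atTop
        (𝓝 (∫ ω, ∫ x, f x ∂(κ ω) ∂P)) := by
      refine tendsto_integral_of_dominated_convergence (fun _ => ‖f‖) (fun n => ?_)
        (integrable_const _) (fun n => Eventually.of_forall fun ω => ?_)
        (hlim.mono fun ω hω => hω f)
      · exact (f.continuous.measurable.comp
          (hjoint n)).stronglyMeasurable.integral_prod_right'.aestronglyMeasurable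
      · simpa using norm_integral_le_of_norm_le_const (μ := ν n)
          (Eventually.of_forall fun x => hbound (φ n ω x))
    simp_rw [h₁] at h₂
    rw [tendsto_nhds_unique tendsto_const_nhds h₂, Measure.snd, integral_map
      measurable_snd.aemeasurable f.continuous.measurable.aestronglyMeasurable,
      Measure.integral_compProd]
    · rfl
    · exact Integrable.of_bound
        (f.continuous.measurable.comp measurable_snd).aestronglyMeasurable ‖f‖
        (Eventually.of_forall fun p => hbound _)
  rw [← hmean, Measure.snd_apply hB, ← Set.univ_prod, Measure.compProd_apply_prod .univ hB,
    Measure.restrict_univ]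
  rfl

end Kernels

section Completion

theorem measurableSet_completionOf_iff {Ω : Type*} {m : MeasurableSpace Ω} [MeasurableSpace Ω]
    {ℙ : Measure Ω} {A : Set Ω} :
    MeasurableSet[completionOf ℙ m] A ↔ ∃ B : Set Ω, MeasurableSet[m] B ∧ A =ᵐ[ℙ] B := by
  simp_rw [← measure_symmDiff_eq_zero_iff]
  refine ⟨fun h => ?_, fun h => MeasurableSpace.GenerateMeasurable.basic A h⟩
  induction h with
  | basic A hA => exact hA
  | empty => exact ⟨∅, @MeasurableSet.empty _ m, by simp⟩
  | compl A _ ih =>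
    obtain ⟨B, hB, h⟩ := ih
    rw [measure_symmDiff_eq_zero_iff] at h
    exact ⟨Bᶜ, hB.compl, measure_symmDiff_eq_zero_iff.2 h.compl⟩
  | iUnion A _ ih =>
    choose B hB h using ih
    simp_rw [measure_symmDiff_eq_zero_iff] at h
    exact ⟨⋃ n, B n, MeasurableSet.iUnion hB,
      measure_symmDiff_eq_zero_iff.2 (Filter.EventuallyEq.countable_iUnion h)⟩

theorem le_completionOf {Ω : Type*} {m : MeasurableSpace Ω} [MeasurableSpace Ω]
    {ℙ : Measure Ω} : m ≤ completionOf ℙ m := fun A hA =>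
  measurableSet_completionOf_iff.2 ⟨A, hA, EventuallyEq.rfl⟩

theorem measurableSet_completionOf_congr {Ω : Type*} {m : MeasurableSpace Ω} [MeasurableSpace Ω]
    {ℙ : Measure Ω} {A B : Set Ω} (hA : MeasurableSet[completionOf ℙ m] A)
    (h : B =ᵐ[ℙ] A) : MeasurableSet[completionOf ℙ m] B := by
  obtain ⟨C, hC, hAC⟩ := measurableSet_completionOf_iff.1 hA
  exact measurableSet_completionOf_iff.2 ⟨C, hC, h.trans hAC⟩

theorem measurable_completionOf_congr {Ω Y : Type*} {m : MeasurableSpace Ω} [MeasurableSpace Ω]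
    [MeasurableSpace Y] {ℙ : Measure Ω} {g h : Ω → Y}
    (hg : Measurable[completionOf ℙ m] g) (hgh : h =ᵐ[ℙ] g) :
    Measurable[completionOf ℙ m] h := fun _ hB =>
  measurableSet_completionOf_congr (hg hB) (hgh.preimage _)

end Completion

section Flow

/-- The flow, with the maps replaced by a constant on the exceptional set `N`. -/
noncomputable def modifiedFlow {Ω X : Type*} (S : ℝ → ℝ → Ω → X → X) (N : Set Ω) (x₀ : X)
    (t s : ℝ) (ω : Ω) (x : X) : X :=
  open Classical in if ω ∈ N then x₀ else S t s ω x

/-- The limiting random measures, replaced by a Dirac mass on the exceptional set `N`. -/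
noncomputable def modifiedLimit {Ω X : Type*} [MeasurableSpace X] (μ : Ω → Measure X)
    (N : Set Ω) (x₀ : X) (ω : Ω) : Measure X :=
  open Classical in if ω ∈ N then Measure.dirac x₀ else μ ω

theorem IsStochasticFlow.measurable_apply {Ω X : Type*} [MeasurableSpace Ω] [MetricSpace X]
    [MeasurableSpace X] [BorelSpace X] {ℙ : Measure Ω} {S : ℝ → ℝ → Ω → X → X}
    (hS : IsStochasticFlow ℙ S) {s t : ℝ} (hst : s ≤ t) (x : X) :
    Measurable fun ω => S t s ω x :=
  (hS.2 t x).comp (measurable_prodMk_left (x := (⟨s, hst⟩ : {s : ℝ // s ≤ t})))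

theorem measurable_sigmaLe {Ω X : Type*} [MeasurableSpace X] (S : ℝ → ℝ → Ω → X → X)
    {s t : ℝ} (hst : s ≤ t) (x : X) : Measurable[sigmaLe S t] fun ω => S t s ω x :=
  fun B hB => MeasurableSpace.measurableSet_generateFrom ⟨s, t, x, B, hst, le_rfl, hB, rfl⟩

theorem measurable_modifiedFlow {Ω X : Type*} [MeasurableSpace Ω] [MeasurableSpace X]
    {S : ℝ → ℝ → Ω → X → X} {N : Set Ω} (hN : MeasurableSet N) (x₀ : X) {s t : ℝ} {x : X}
    (h : Measurable fun ω => S t s ω x) : Measurable fun ω => modifiedFlow S N x₀ t s ω x := by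
  classical
  exact Measurable.ite hN measurable_const h

theorem continuous_modifiedFlow {Ω X : Type*} [TopologicalSpace X]
    {S : ℝ → ℝ → Ω → X → X} {N : Set Ω} (x₀ : X) {s t : ℝ}
    (h : ∀ ω ∉ N, Continuous (S t s ω)) (ω : Ω) : Continuous (modifiedFlow S N x₀ t s ω) := by
  by_cases hω : ω ∈ N
  · have hconst : modifiedFlow S N x₀ t s ω = fun _ => x₀ := by
      ext x
      simp [modifiedFlow, hω]
    exact hconst ▸ continuous_const
  · have hflow : modifiedFlow S N x₀ t s ω = S t s ω := by
      ext x
      simp [modifiedFlow, hω]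
    exact hflow ▸ h ω hω

theorem isProbabilityMeasure_modifiedLimit {Ω X : Type*} [MeasurableSpace X]
    {μ : Ω → Measure X} (hμ : ∀ ω, IsProbabilityMeasure (μ ω)) (N : Set Ω) (x₀ : X) (ω : Ω) :
    IsProbabilityMeasure (modifiedLimit μ N x₀ ω) := by
  unfold modifiedLimit
  split_ifs
  · infer_instance
  · exact hμ ω

/-- Outside a measurable null set, the flow is regular and the pullback limit at time `t`
exists. -/
theorem exists_null_set_pullback_limit {Ω X : Type*} [MeasurableSpace Ω] [MetricSpace X]
    [MeasurableSpace X] [BorelSpace X] {ℙ : Measure Ω} {S : ℝ → ℝ → Ω → X → X}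
    (hS : IsStochasticFlow ℙ S) {ρ : ℝ → Measure X} (hρ : ∀ t, IsProbabilityMeasure (ρ t))
    {μ : Ω → Measure X} (x₀ : X) (t : ℝ)
    (hlim : ∀ᵐ ω ∂ℙ, ∀ f : BoundedContinuousFunction X ℝ,
      Tendsto (fun n : ℕ => ∫ x, f x ∂((ρ (t - n)).map (S t (t - n) ω))) atTop
        (𝓝 (∫ x, f x ∂(μ ω)))) :
    ∃ N : Set Ω, MeasurableSet N ∧ ℙ N = 0 ∧
      (∀ ω ∉ N, ∀ s t : ℝ, s ≤ t → Continuous (S t s ω)) ∧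
      ∀ ω (f : BoundedContinuousFunction X ℝ),
        Tendsto (fun n : ℕ => ∫ x, f (modifiedFlow S N x₀ t (t - n) ω x) ∂(ρ (t - n))) atTop
          (𝓝 (∫ x, f x ∂(modifiedLimit μ N x₀ ω))) := by
  obtain ⟨N, hsub, hN, hN₀⟩ := exists_measurable_superset_of_null (ae_iff.1 (hS.1.and hlim))
  have hgood := fun ω (hω : ω ∉ N) => not_not.1 fun h => hω (hsub h)
  refine ⟨N, hN, hN₀, fun ω hω => (hgood ω hω).1.2.1, fun ω f => ?_⟩
  by_cases hω : ω ∈ N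
  · simp [modifiedFlow, modifiedLimit, hω, integral_dirac' _ _ f.continuous.stronglyMeasurable]
  · simp only [modifiedFlow, modifiedLimit, hω, if_false]
    refine ((hgood ω hω).2 f).congr fun n => ?_
    exact integral_map ((hgood ω hω).1.2.1 _ _ (by simp)).measurable.aemeasurable
      f.continuous.measurable.aestronglyMeasurable

/-- The pullback limits are almost surely transported to each other by the flow. -/
theorem ae_map_pullback_limit_eq {Ω X : Type*} [MeasurableSpace Ω] [MetricSpace X]
    [MeasurableSpace X] [BorelSpace X] {ℙ : Measure Ω} {S : ℝ → ℝ → Ω → X → X}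
    (hS : IsStochasticFlow ℙ S) {ρ : ℝ → Measure X}
    {μ : ℝ → Ω → Measure X} (hμ : ∀ t ω, IsProbabilityMeasure (μ t ω))
    (hlim : ∀ t : ℝ, ∀ s : ℕ → ℝ, Tendsto s atTop atBot →
      ∀ᵐ ω ∂ℙ, ∀ f : BoundedContinuousFunction X ℝ,
        Tendsto (fun n => ∫ x, f x ∂((ρ (s n)).map (S t (s n) ω))) atTop
          (𝓝 (∫ x, f x ∂(μ t ω)))) {s t : ℝ} (hst : s ≤ t) :
    ∀ᵐ ω ∂ℙ, (μ s ω).map (S t s ω) = μ t ω := by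
  have hseq : Tendsto (fun n : ℕ => s - (n : ℝ)) atTop atBot :=
    tendsto_const_nhds.add_atBot (tendsto_neg_atTop_atBot.comp tendsto_natCast_atTop_atTop)
  filter_upwards [hS.1, hlim s _ hseq, hlim t _ hseq] with ω hω hs ht
  have hc := hω.2.1
  have hle : ∀ n : ℕ, s - (n : ℝ) ≤ s := fun n => by simp
  have := Measure.isProbabilityMeasure_map (μ := μ s ω) (hc s t hst).measurable.aemeasurable
  refine ext_of_forall_integral_eq_of_IsFiniteMeasure fun f => ?_
  refine tendsto_nhds_unique ?_ (ht f)
  rw [integral_map (hc s t hst).measurable.aemeasurable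
    f.continuous.measurable.aestronglyMeasurable]
  refine (hs (f.compContinuous ⟨S t s ω, hc s t hst⟩)).congr fun n => ?_
  have hcomp : S t (s - n) ω = S t s ω ∘ S s (s - n) ω :=
    funext fun x => (hω.1 _ _ _ (hle n) hst x).symm
  rw [hcomp, ← Measure.map_map (hc s t hst).measurable (hc _ _ (hle n)).measurable,
    integral_map (hc s t hst).measurable.aemeasurable
      f.continuous.measurable.aestronglyMeasurable]
  rfl

end Flow

section EvolutionSystem

open ProbabilityTheory

/-- Fibrewise transport by a measurable family of maps passes to the measures on `Ω × X`. -/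
theorem map_compProd_eq {Ω X : Type*} [MeasurableSpace Ω] [MeasurableSpace X]
    (P : Measure Ω) [IsProbabilityMeasure P] (κ η : Kernel Ω X) [IsMarkovKernel κ]
    [IsMarkovKernel η] {φ : Ω → X → X} (hφ : Measurable fun p : Ω × X => φ p.1 p.2)
    (h : ∀ᵐ ω ∂P, (κ ω).map (φ ω) = η ω) :
    (P ⊗ₘ κ).map (fun p : Ω × X => (p.1, φ p.1 p.2)) = P ⊗ₘ η := by
  have hΨ : Measurable fun p : Ω × X => (p.1, φ p.1 p.2) := measurable_fst.prodMk hφ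
  ext A hA
  rw [Measure.map_apply hΨ hA, Measure.compProd_apply (hΨ hA), Measure.compProd_apply hA]
  refine lintegral_congr_ae (h.mono fun ω hω => ?_)
  have hφω : Measurable (φ ω) := hφ.comp measurable_prodMk_left
  simp only [← hω]
  rw [Measure.map_apply hφω (measurable_prodMk_left hA)]
  rfl

end EvolutionSystem

/-- let `S` be a white noise stochastic flow and `ρ` an evolution system of
measures for its Markov semigroup; for each `t` let `μ t ω` be the a.s. weak limit (along
deterministic sequences `s_n → -∞`) of the pushforwards `S(t,s_n;ω) ρ_{s_n}`. Then
(i) the measures `μbar t` on `Ω × X` with disintegration `μ t` form an evolution system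
of measures for `S`; (ii) `ω ↦ μ t ω B` is `𝓕_{≤ t}`-measurable for each Borel `B`;
(iii) `𝔼[μ t ω B] = ρ t B` for all `t` and Borel `B`. -/
theorem stmt11 {Ω X : Type*} [MeasurableSpace Ω] [MetricSpace X] [CompleteSpace X]
    [TopologicalSpace.SeparableSpace X] [MeasurableSpace X] [BorelSpace X]
    (ℙ : Measure Ω) [IsProbabilityMeasure ℙ]
    (S : ℝ → ℝ → Ω → X → X) (hS : IsWhiteNoiseFlow ℙ S)
    (ρ : ℝ → Measure X) (hρ : IsMarkovEvolutionSystem ℙ S ρ)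
    (μ : ℝ → Ω → Measure X)
    (hprob : ∀ (t : ℝ) (ω : Ω), IsProbabilityMeasure (μ t ω))
    (hlim : ∀ t : ℝ, ∀ s : ℕ → ℝ, Tendsto s atTop atBot →
      ∀ᵐ ω ∂ℙ, ∀ f : BoundedContinuousFunction X ℝ,
        Tendsto (fun n => ∫ x, f x ∂((ρ (s n)).map (S t (s n) ω))) atTop
          (𝓝 (∫ x, f x ∂(μ t ω)))) :
    (∀ μbar : ℝ → Measure (Ω × X),
      (∀ (t : ℝ) (F : Set Ω) (B : Set X), MeasurableSet F → MeasurableSet B →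
        μbar t (F ×ˢ B) = ∫⁻ ω in F, μ t ω B ∂ℙ) →
      IsEvolutionSystem ℙ S μbar) ∧
    (∀ (t : ℝ) (B : Set X), MeasurableSet B →
      Measurable[Fle ℙ S t] fun ω => μ t ω B) ∧
    (∀ (t : ℝ) (B : Set X), MeasurableSet B → (∫⁻ ω, μ t ω B ∂ℙ) = ρ t B) := by
  obtain ⟨hflow, -⟩ := hS
  obtain ⟨hρprob, hρ⟩ := hρ
  have : SecondCountableTopology X := UniformSpace.secondCountable_of_separable X
  obtain ⟨x₀⟩ : Nonempty X := (ρ 0).nonempty_of_neZero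
  have hseq : ∀ t : ℝ, Tendsto (fun n : ℕ => t - (n : ℝ)) atTop atBot := fun t =>
    tendsto_const_nhds.add_atBot (tendsto_neg_atTop_atBot.comp tendsto_natCast_atTop_atTop)
  have hle : ∀ (t : ℝ) (n : ℕ), t - (n : ℝ) ≤ t := fun t n => by simp
  choose N hN hN₀ hcont hconv using fun t =>
    exists_null_set_pullback_limit hflow hρprob x₀ t (hlim t _ (hseq t))
  have hnotin : ∀ t, ∀ᵐ ω ∂ℙ, ω ∉ N t := fun t => measure_eq_zero_iff_ae_notMem.1 (hN₀ t)
  let κ : ℝ → Ω → Measure X := fun t => modifiedLimit (μ t) (N t) x₀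
  have hκprob : ∀ t ω, IsProbabilityMeasure (κ t ω) := fun t =>
    isProbabilityMeasure_modifiedLimit (hprob t) (N t) x₀
  have hκμ : ∀ t, μ t =ᵐ[ℙ] κ t := fun t => (hnotin t).mono fun ω hω => by
    simp [κ, modifiedLimit, hω]
  have hΦm : ∀ t s, s ≤ t → ∀ x, Measurable fun ω => modifiedFlow S (N t) x₀ t s ω x :=
    fun t s hst x => measurable_modifiedFlow (hN t) x₀ (hflow.measurable_apply hst x)
  have hΦc : ∀ t s, s ≤ t → ∀ ω, Continuous (modifiedFlow S (N t) x₀ t s ω) :=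
    fun t s hst => continuous_modifiedFlow x₀ fun ω hω => hcont t ω hω s t hst
  have hκm : ∀ t, Measurable (κ t) := fun t =>
    measurable_of_tendsto_integral_comp (hκprob t) (fun n => hΦm t _ (hle t n))
      (fun n => hΦc t _ (hle t n)) (fun n => hρprob _) (hconv t)
  refine ⟨fun μbar hμbar => ?_, fun t B hB => ?_, fun t B hB => ?_⟩
  · let K : ℝ → ProbabilityTheory.Kernel Ω X := fun t => ⟨κ t, hκm t⟩
    have hK : ∀ t, ProbabilityTheory.IsMarkovKernel (K t) := fun t => ⟨hκprob t⟩
    have hbar : ∀ t, ℙ.compProd (K t) = μbar t := fun t => Measure.ext_prod fun hF hB => by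
      rw [Measure.compProd_apply_prod hF hB, hμbar t _ _ hF hB]
      exact lintegral_congr_ae (ae_restrict_of_ae ((hκμ t).mono fun ω hω =>
        congrArg (fun ν : Measure X => ν _) hω.symm))
    simp only [IsEvolutionSystem, ← hbar]
    refine ⟨fun t => inferInstance, fun t => Measure.fst_compProd ℙ (K t), fun s t hst => ?_⟩
    rw [← map_compProd_eq ℙ (K s) (K t) (φ := modifiedFlow S (N t) x₀ t s)
      ((measurable_uncurry_of_continuous_of_measurable
        (u := fun x ω => modifiedFlow S (N t) x₀ t s ω x) (hΦc t s hst) (hΦm t s hst)).comp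
          measurable_swap)]
    · refine Measure.map_congr ?_
      have hfst : ∀ᵐ p ∂(ℙ.compProd (K s)), p.1 ∉ N t := by
        refine ae_of_ae_map (p := fun ω => ω ∉ N t) measurable_fst.aemeasurable ?_
        have := Measure.fst_compProd ℙ (K s)
        rw [Measure.fst] at this
        rw [this]
        exact hnotin t
      filter_upwards [hfst] with p hp
      simp [modifiedFlow, hp]
    · filter_upwards [ae_map_pullback_limit_eq hflow hprob hlim hst, hκμ s, hκμ t, hnotin t]
        with ω hω hs ht hn
      have hmod : modifiedFlow S (N t) x₀ t s ω = S t s ω := by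
        ext x
        simp [modifiedFlow, hn]
      change (κ s ω).map _ = κ t ω
      rw [hmod, ← hs, ← ht, hω]
  · have hNt : MeasurableSet[Fle ℙ S t] (N t) :=
      measurableSet_completionOf_iff.2
        ⟨∅, @MeasurableSet.empty _ (sigmaLe S t), ae_eq_empty.2 (hN₀ t)⟩
    have hκF : Measurable[Fle ℙ S t] (κ t) :=
      @measurable_of_tendsto_integral_comp Ω X (Fle ℙ S t) _ _ _ _ _ (hκprob t) _
        (fun n x => @measurable_modifiedFlow Ω X (Fle ℙ S t) _ _ _ hNt _ _ _ _
          ((measurable_sigmaLe S (hle t n) x).mono le_completionOf le_rfl))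
        (fun n => hΦc t _ (hle t n)) _ (fun n => hρprob _) (hconv t)
    exact measurable_completionOf_congr ((Measure.measurable_coe hB).comp hκF)
      ((hκμ t).mono fun ω hω => by simp [hω])
  · rw [lintegral_congr_ae ((hκμ t).mono fun ω hω => congrArg (· B) hω)]
    refine lintegral_limit_eq ℙ (hκprob t) (hκm t) (fun n => hΦm t _ (hle t n))
      (fun n => hΦc t _ (hle t n)) (fun n => hρprob _)
      (Eventually.of_forall (hconv t)) (ρ t) (fun n A hA => ?_) hB
    rw [← hρ _ _ (hle t n) A hA]
    refine lintegral_congr fun x => measure_congr (eventuallyEq_set.2 ?_)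
    filter_upwards [hnotin t] with ω hω
    simp [modifiedFlow, hω]
end
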